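/- arXiv:2006.01539 — 3 statements merged into one kernel-verified Lean document; each statement's English description precedes it below -/
import Mathlib

section
/- Let 𝒜, ℬ, 𝒞 be linear maps from the space of real 3×3 matrices to itself, with 𝒜 and 𝒞 self-adjoint with respect to the Frobenius inner product, and let R₀ be a 3×3 rotation matrix (R₀ᵀR₀ = I, det R₀ = 1). Suppose that for all smooth, compactly supported vector fields ξ, η : ℝ³ → ℝ³ one has ∫_{ℝ³} ( ⟪R₀ᵀ∇ξ(Y), 𝒜[R₀ᵀ∇ξ(Y)]⟫ + 2⟪R₀ᵀ∇ξ(Y), ℬ[R₀ᵀ∇η(Y)]⟫ + ⟪R₀ᵀ∇η(Y), 𝒞[R₀ᵀ∇η(Y)]⟫ ) dY ≥ 0. Then for all vectors a, b, n ∈ ℝ³ the Legendre–Hadamard inequality holds: ⟪a⊗n, 𝒜[a⊗n]⟫ + 2⟪a⊗n, ℬ[b⊗n]⟫ + ⟪b⊗n, 𝒞[b⊗n]⟫ ≥ 0. -/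
open Matrix MeasureTheory

/-- Frobenius inner product on real 3×3 matrices: ⟪A,B⟫ = tr(ABᵀ). -/
noncomputable def frob (A B : Matrix (Fin 3) (Fin 3) ℝ) : ℝ := (A * Bᵀ).trace

/-- Gradient matrix of a vector field ξ : ℝ³ → ℝ³, with (∇ξ)ᵢⱼ = ∂ξᵢ/∂Yⱼ. -/
noncomputable def gradMat (ξ : (Fin 3 → ℝ) → (Fin 3 → ℝ)) (Y : Fin 3 → ℝ) :
    Matrix (Fin 3) (Fin 3) ℝ :=
  fun i j => fderiv ℝ ξ Y (Pi.single j 1) i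

/-- The gradient of a scalar function on `ι → ℝ`, as a vector of partial derivatives. -/
noncomputable def gradVec {ι : Type*} [Fintype ι] [DecidableEq ι] (u : (ι → ℝ) → ℝ) (Y : ι → ℝ) :
    ι → ℝ :=
  fun j => fderiv ℝ u Y (Pi.single j 1)

lemma hasCompactSupport_sq {X : Type*} [TopologicalSpace X] {φ : X → ℝ} (hc : HasCompactSupport φ) :
    HasCompactSupport fun x => φ x ^ 2 :=
  hc.comp_left (g := fun t : ℝ => t ^ 2) (by simp)

section GradVec

variable {ι : Type*} [Fintype ι] [DecidableEq ι]

lemma continuous_gradVec {u : (ι → ℝ) → ℝ} (hu : ContDiff ℝ (⊤ : ℕ∞) u) :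
    Continuous (gradVec u) :=
  continuous_pi fun _ => (hu.continuous_fderiv (by simp)).clm_apply continuous_const

lemma hasCompactSupport_gradVec {u : (ι → ℝ) → ℝ} (hu : HasCompactSupport u) :
    HasCompactSupport (gradVec u) :=
  (hu.fderiv ℝ).comp_left (g := fun L : (ι → ℝ) →L[ℝ] ℝ => fun j => L (Pi.single j 1)) rfl

lemma gradVec_mul_comp_dotProduct {φ : (ι → ℝ) → ℝ} {f : ℝ → ℝ} {f' : ℝ} {n Y : ι → ℝ}
    (hφ : DifferentiableAt ℝ φ Y) (hf : HasDerivAt f f' (n ⬝ᵥ Y)) :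
    gradVec (fun Z => φ Z * f (n ⬝ᵥ Z)) Y = f (n ⬝ᵥ Y) • gradVec φ Y + (φ Y * f') • n := by
  have hdot : HasFDerivAt (fun Z => n ⬝ᵥ Z) (dotProductBilin ℝ ℝ n).toContinuousLinearMap Y :=
    (dotProductBilin ℝ ℝ n).toContinuousLinearMap.hasFDerivAt
  have h : HasFDerivAt (fun Z => φ Z * f (n ⬝ᵥ Z)) _ Y :=
    hφ.hasFDerivAt.mul (hf.comp_hasFDerivAt Y hdot)
  ext j
  simp [gradVec, h.fderiv]
  ring

lemma integrable_bilin_gradVec (B : (ι → ℝ) →ₗ[ℝ] (ι → ℝ) →ₗ[ℝ] ℝ) {u : (ι → ℝ) → ℝ}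
    (hu : ContDiff ℝ (⊤ : ℕ∞) u) (hc : HasCompactSupport u) :
    Integrable fun Y => B (gradVec u Y) (gradVec u Y) := by
  have hB : Continuous fun g : ι → ℝ => B g g := by
    have h := (LinearMap.toContinuousLinearMap.toLinearMap ∘ₗ B).continuous_of_finiteDimensional
    exact h.clm_apply continuous_id
  exact (hB.comp (continuous_gradVec hu)).integrable_of_hasCompactSupport
    ((hasCompactSupport_gradVec hc).comp_left (g := fun g => B g g) (by simp))

/-- Testing with `φ * cos (n ⬝ᵥ ·)` and `φ * sin (n ⬝ᵥ ·)` decouples `φ` from the direction `n`. -/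
lemma integral_bilin_gradVec_add_nonneg (B : (ι → ℝ) →ₗ[ℝ] (ι → ℝ) →ₗ[ℝ] ℝ)
    (H : ∀ u : (ι → ℝ) → ℝ, ContDiff ℝ (⊤ : ℕ∞) u → HasCompactSupport u →
      0 ≤ ∫ Y, B (gradVec u Y) (gradVec u Y)) {φ : (ι → ℝ) → ℝ} (hφ : ContDiff ℝ (⊤ : ℕ∞) φ)
    (hφc : HasCompactSupport φ) (n : ι → ℝ) :
    0 ≤ (∫ Y, B (gradVec φ Y) (gradVec φ Y)) + B n n * ∫ Y, φ Y ^ 2 := by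
  have hsq : Integrable fun Y => φ Y ^ 2 :=
    (hφ.continuous.pow 2).integrable_of_hasCompactSupport (hasCompactSupport_sq hφc)
  have hdot : ContDiff ℝ (⊤ : ℕ∞) fun Y => n ⬝ᵥ Y :=
    (dotProductBilin ℝ ℝ n).toContinuousLinearMap.contDiff
  have hu := hφ.mul (Real.contDiff_cos.comp hdot)
  have hv := hφ.mul (Real.contDiff_sin.comp hdot)
  have huc : HasCompactSupport fun Y => φ Y * Real.cos (n ⬝ᵥ Y) := hφc.mul_right
  have hvc : HasCompactSupport fun Y => φ Y * Real.sin (n ⬝ᵥ Y) := hφc.mul_right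
  have h := add_nonneg (H _ hu huc) (H _ hv hvc)
  rw [← integral_add (integrable_bilin_gradVec B hu huc) (integrable_bilin_gradVec B hv hvc)] at h
  rw [← integral_const_mul, ← integral_add (integrable_bilin_gradVec B hφ hφc)
    (hsq.const_mul _)]
  refine h.trans_eq (integral_congr_ae (.of_forall fun Y => ?_))
  have hd : DifferentiableAt ℝ φ Y := hφ.differentiable (by simp) Y
  have hcos := gradVec_mul_comp_dotProduct hd (Real.hasDerivAt_cos (n ⬝ᵥ Y))
  have hsin := gradVec_mul_comp_dotProduct hd (Real.hasDerivAt_sin (n ⬝ᵥ Y))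
  simp only [Function.comp_apply, hcos, hsin, map_add, map_smul, LinearMap.add_apply,
    LinearMap.smul_apply, smul_eq_mul]
  linear_combination (B (gradVec φ Y) (gradVec φ Y) + B n n * φ Y ^ 2) *
    Real.sin_sq_add_cos_sq (n ⬝ᵥ Y)

/-- A quadratic form whose integral over gradients of test functions is nonnegative is nonnegative. -/
theorem bilin_self_nonneg_of_integral_gradVec_nonneg (B : (ι → ℝ) →ₗ[ℝ] (ι → ℝ) →ₗ[ℝ] ℝ)
    (H : ∀ u : (ι → ℝ) → ℝ, ContDiff ℝ (⊤ : ℕ∞) u → HasCompactSupport u →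
      0 ≤ ∫ Y, B (gradVec u Y) (gradVec u Y)) (n : ι → ℝ) :
    0 ≤ B n n := by
  obtain ⟨φ⟩ : Nonempty (ContDiffBump (0 : ι → ℝ)) := inferInstance
  have hφ : ContDiff ℝ (⊤ : ℕ∞) φ := φ.contDiff
  have hφc : HasCompactSupport φ := φ.hasCompactSupport
  have hpos : 0 < ∫ Y, φ Y ^ 2 := by
    refine (φ.continuous.pow 2).integral_pos_of_hasCompactSupport_nonneg_nonzero
      (hasCompactSupport_sq hφc) (fun Y => sq_nonneg _) (x := 0) ?_
    simp [φ.one_of_mem_closedBall (Metric.mem_closedBall_self φ.rIn_pos.le)]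
  by_contra! hneg
  obtain ⟨k, hk⟩ := exists_nat_gt
    ((∫ Y, B (gradVec φ Y) (gradVec φ Y)) / (-B n n * ∫ Y, φ Y ^ 2))
  rw [div_lt_iff₀ (mul_pos (neg_pos.2 hneg) hpos)] at hk
  have h := integral_bilin_gradVec_add_nonneg B H hφ hφc ((k : ℝ) • n)
  simp only [map_smul, LinearMap.smul_apply, smul_eq_mul] at h
  have hkk : (k : ℝ) ≤ (k : ℝ) ^ 2 := by exact_mod_cast Nat.le_self_pow two_ne_zero k
  nlinarith [mul_le_mul_of_nonneg_right hkk (mul_pos (neg_pos.2 hneg) hpos).le]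

end GradVec

/-- `frob` as a bilinear map. -/
noncomputable def frobBilin :
    Matrix (Fin 3) (Fin 3) ℝ →ₗ[ℝ] Matrix (Fin 3) (Fin 3) ℝ →ₗ[ℝ] ℝ :=
  LinearMap.mk₂ ℝ frob (by simp [frob, add_mul]) (by simp [frob]) (by simp [frob, mul_add])
    (by simp [frob])

lemma gradMat_smul_const {u : (Fin 3 → ℝ) → ℝ} {Y : Fin 3 → ℝ} (hu : DifferentiableAt ℝ u Y)
    (a : Fin 3 → ℝ) : gradMat (fun Z => u Z • a) Y = vecMulVec a (gradVec u Y) := by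
  ext i j
  simp [gradMat, gradVec, fderiv_smul_const hu, vecMulVec_apply, mul_comm]

theorem legendre_hadamard_from_second_variation
    (𝒜 ℬ 𝒞 : Matrix (Fin 3) (Fin 3) ℝ →ₗ[ℝ] Matrix (Fin 3) (Fin 3) ℝ)
    (hA : ∀ A B, frob A (𝒜 B) = frob B (𝒜 A))
    (hC : ∀ A B, frob A (𝒞 B) = frob B (𝒞 A))
    (R₀ : Matrix (Fin 3) (Fin 3) ℝ)
    (hR₀ : R₀ᵀ * R₀ = 1) (hdet : R₀.det = 1)
    (H : ∀ ξ η : (Fin 3 → ℝ) → (Fin 3 → ℝ),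
      ContDiff ℝ (⊤ : ℕ∞) ξ → ContDiff ℝ (⊤ : ℕ∞) η →
      HasCompactSupport ξ → HasCompactSupport η →
      0 ≤ ∫ Y : Fin 3 → ℝ,
        (frob (R₀ᵀ * gradMat ξ Y) (𝒜 (R₀ᵀ * gradMat ξ Y))
          + 2 * frob (R₀ᵀ * gradMat ξ Y) (ℬ (R₀ᵀ * gradMat η Y))
          + frob (R₀ᵀ * gradMat η Y) (𝒞 (R₀ᵀ * gradMat η Y)))) :
    ∀ a b n : Fin 3 → ℝ,
      0 ≤ frob (vecMulVec a n) (𝒜 (vecMulVec a n))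
        + 2 * frob (vecMulVec a n) (ℬ (vecMulVec b n))
        + frob (vecMulVec b n) (𝒞 (vecMulVec b n)) := by
  intro a b n
  let T (c : Fin 3 → ℝ) : (Fin 3 → ℝ) →ₗ[ℝ] Matrix (Fin 3) (Fin 3) ℝ := vecMulVecBilin ℝ ℝ c
  let B : (Fin 3 → ℝ) →ₗ[ℝ] (Fin 3 → ℝ) →ₗ[ℝ] ℝ :=
    frobBilin.compl₁₂ (T a) (𝒜 ∘ₗ T a) + (2 : ℝ) • frobBilin.compl₁₂ (T a) (ℬ ∘ₗ T b) +
      frobBilin.compl₁₂ (T b) (𝒞 ∘ₗ T b)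
  have hB (g : Fin 3 → ℝ) : B g g = frob (vecMulVec a g) (𝒜 (vecMulVec a g))
      + 2 * frob (vecMulVec a g) (ℬ (vecMulVec b g))
      + frob (vecMulVec b g) (𝒞 (vecMulVec b g)) := rfl
  rw [← hB]
  refine bilin_self_nonneg_of_integral_gradVec_nonneg B (fun u hu hc => ?_) n
  have hgrad (c Y : Fin 3 → ℝ) :
      R₀ᵀ * gradMat (fun Z => u Z • (R₀ *ᵥ c)) Y = vecMulVec c (gradVec u Y) := by
    rw [gradMat_smul_const (hu.differentiable (by simp) Y), mul_vecMulVec, mulVec_mulVec, hR₀,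
      one_mulVec]
  simpa only [hgrad, hB] using H (fun Z => u Z • (R₀ *ᵥ a)) (fun Z => u Z • (R₀ *ᵥ b))
    (hu.smul contDiff_const) (hu.smul contDiff_const) hc.smul_right hc.smul_right
end

section
/- Let R be a 3×3 orthogonal matrix (RᵀR = I), let σ, F, H be arbitrary real 3×3 matrices, let Ω be a skew-symmetric 3×3 matrix with axial vector ω = axl Ω, and set E = RᵀF. Then ⟪σ, Rᵀ(H − ΩF)⟫ = ⟪Rσ, H⟫ − 2 ⟨ axl( R · skew(σEᵀ) · Rᵀ ), ω ⟩, where skew(A) = (A − Aᵀ)/2. -/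
open Matrix

/-- Skew part of a matrix: skew A = (A − Aᵀ)/2. -/
noncomputable def skewPart (A : Matrix (Fin 3) (Fin 3) ℝ) : Matrix (Fin 3) (Fin 3) ℝ :=
  (1 / 2 : ℝ) • (A - Aᵀ)

/-- Axial vector of a (skew) 3×3 matrix: axl W = (W₃₂, W₁₃, W₂₁) (1-based indexing). -/
def axl (W : Matrix (Fin 3) (Fin 3) ℝ) : Fin 3 → ℝ := ![W 2 1, W 0 2, W 1 0]

theorem frob_eq_two_mul_axl_dotProduct (A W : Matrix (Fin 3) (Fin 3) ℝ) (hW : Wᵀ = -W) :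
    frob A W = 2 * (axl (skewPart A) ⬝ᵥ axl W) := by
  have h (i j : Fin 3) : W j i = -W i j := congrFun (congrFun hW i) j
  have h00 : W 0 0 = 0 := by linarith [h 0 0]
  have h11 : W 1 1 = 0 := by linarith [h 1 1]
  have h22 : W 2 2 = 0 := by linarith [h 2 2]
  simp [frob, axl, skewPart, trace_fin_three, mul_apply, Fin.sum_univ_three, dotProduct,
    h00, h11, h22, h 1 0, h 0 2, h 2 1]
  ring

theorem mul_skewPart_mul_transpose (R A : Matrix (Fin 3) (Fin 3) ℝ) :
    R * skewPart A * Rᵀ = skewPart (R * A * Rᵀ) := by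
  simp [skewPart, mul_sub, sub_mul, Matrix.mul_assoc]

theorem stress_power_identity
    (R σ F H Ω : Matrix (Fin 3) (Fin 3) ℝ)
    (hR : Rᵀ * R = 1)
    (hΩ : Ωᵀ = -Ω)
    (E : Matrix (Fin 3) (Fin 3) ℝ) (hE : E = Rᵀ * F) :
    frob σ (Rᵀ * (H - Ω * F))
      = frob (R * σ) H
        - 2 * (axl (R * skewPart (σ * Eᵀ) * Rᵀ) ⬝ᵥ axl Ω) := by
  have hR' : R * Rᵀ = 1 := mul_eq_one_comm.mp hR
  have hM : R * (σ * Eᵀ) * Rᵀ = R * σ * Fᵀ := by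
    rw [hE, transpose_mul, transpose_transpose]
    simp only [Matrix.mul_assoc, hR', Matrix.mul_one]
  rw [mul_skewPart_mul_transpose, hM, ← frob_eq_two_mul_axl_dotProduct _ _ hΩ]
  simp only [frob, transpose_mul, transpose_sub, transpose_transpose]
  rw [← Matrix.mul_assoc, trace_mul_comm, ← Matrix.mul_assoc, mul_sub, trace_sub,
    Matrix.mul_assoc (R * σ)]
end

section
/- Let a₁, a₂, a₃ ∈ ℝ and let 𝒞 be the linear map on real 3×3 matrices given by 𝒞[X] = 2a₁·dev(sym X) + 2a₂·skew X + (2a₃/3)·(tr X)·I. Then for all vectors b, n ∈ ℝ³: ⟪ b⊗n , 𝒞[b⊗n] ⟫ = a₁(‖b‖²‖n‖² + ⟨b,n⟩²) + a₂(‖b‖²‖n‖² − ⟨b,n⟩²) + (2/3)(a₃ − a₁)⟨b,n⟩². -/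
open Matrix

/-- Symmetric part of a matrix: sym A = (A + Aᵀ)/2. -/
noncomputable def symPart (A : Matrix (Fin 3) (Fin 3) ℝ) : Matrix (Fin 3) (Fin 3) ℝ :=
  (1 / 2 : ℝ) • (A + Aᵀ)

/-- Deviatoric part of a matrix: dev A = A − (tr A / 3) I. -/
noncomputable def devPart (A : Matrix (Fin 3) (Fin 3) ℝ) : Matrix (Fin 3) (Fin 3) ℝ :=
  A - (A.trace / 3) • (1 : Matrix (Fin 3) (Fin 3) ℝ)

theorem WGammaGamma_quadratic_form
    (a₁ a₂ a₃ : ℝ)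
    (𝒞 : Matrix (Fin 3) (Fin 3) ℝ → Matrix (Fin 3) (Fin 3) ℝ)
    (h𝒞 : 𝒞 = fun X => (2 * a₁) • devPart (symPart X) + (2 * a₂) • skewPart X
      + (2 * a₃ / 3 * X.trace) • (1 : Matrix (Fin 3) (Fin 3) ℝ)) :
    ∀ b n : Fin 3 → ℝ,
      frob (vecMulVec b n) (𝒞 (vecMulVec b n))
        = a₁ * ((b ⬝ᵥ b) * (n ⬝ᵥ n) + (b ⬝ᵥ n) ^ 2)
          + a₂ * ((b ⬝ᵥ b) * (n ⬝ᵥ n) - (b ⬝ᵥ n) ^ 2)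
          + 2 / 3 * (a₃ - a₁) * (b ⬝ᵥ n) ^ 2 := by
  intro b n
  subst h𝒞
  simp [frob, symPart, skewPart, devPart, trace_fin_three, mul_apply, dotProduct,
    Fin.sum_univ_three, vecMulVec_apply]
  ring
end
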